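/- Let k ≥ 2 and let T be a tight component of a k-uniform hypergraph. Then T has at most k reachability components, and moreover every edge of T contains at least one vertex from each reachability component of T. -/

import Mathlib

open scoped Classical

namespace Paper

noncomputable section

variable {V : Type} [Fintype V]

/-- The degree of a vertex, via `Set.ncard`. -/
def ndeg (G : SimpleGraph V) (v : V) : ℕ := (G.neighborSet v).ncard

/-- A proper colouring with colours `0, …, k-1`. -/
def ProperCol (G : SimpleGraph V) (k : ℕ) (C : V → ℕ) : Prop :=
  (∀ v, C v < k) ∧ ∀ ⦃u v⦄, G.Adj u v → C u ≠ C v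

/-- A topological colouring with colours `0, …, k-1`: every edge is monochromatic. -/
def TopCol (G : SimpleGraph V) (k : ℕ) (C : V → ℕ) : Prop :=
  (∀ v, C v < k) ∧ ∀ ⦃u v⦄, G.Adj u v → C u = C v

/-- The size of the `i`-th colour class of a colouring. -/
def classCard (C : V → ℕ) (i : ℕ) : ℕ := {v | C v = i}.ncard

/-- The chromatic number, as a natural number. -/
def chromNum (G : SimpleGraph V) : ℕ := G.chromaticNumber.toNat

/-- The size of the smallest colour class of a colouring with `k` colours. -/
def minClassCard (C : V → ℕ) (k : ℕ) : ℕ := sInf {a | ∃ i < k, a = classCard C i}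

/-- The minimum, over proper `χ(G)`-colourings, of the size of the smallest colour class. -/
def alphaNat (G : SimpleGraph V) : ℕ :=
  sInf {a | ∃ C, ProperCol G (chromNum G) C ∧ a = minClassCard C (chromNum G)}

/-- `α(G)`: minimum proportion of vertices in a single colour class over proper
`χ(G)`-colourings. -/
def alphaR (G : SimpleGraph V) : ℝ := (alphaNat G : ℝ) / (Fintype.card V : ℝ)

/-- The critical chromatic number `crit(G) = (χ(G) − 1)/(1 − α(G))`. -/
def critR (G : SimpleGraph V) : ℝ := ((chromNum G : ℝ) - 1) / (1 - alphaR G)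

/-- `𝒟(G)`: values `||φ⁻¹(0)| − |φ⁻¹(1)||` over proper `χ(G)`-colourings `φ`. -/
def DSet (G : SimpleGraph V) : Set ℕ :=
  {d | ∃ C, ProperCol G (chromNum G) C ∧
    d = ((classCard C 0 : ℤ) - (classCard C 1 : ℤ)).natAbs}

/-- The set `S ⊆ ℕ` has greatest common divisor `1`.  (Elements `0` are immaterial, and this
fails when `S ⊆ {0}`, matching the convention `gcd = ∞` in that case.) -/
def GcdOne (S : Set ℕ) : Prop := ∃ T : Finset ℕ, ↑T ⊆ S ∧ T.gcd id = 1

/-- The orders of the connected components of `G`. -/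
def compOrders (G : SimpleGraph V) : Set ℕ :=
  {m | ∃ c : G.ConnectedComponent, m = c.supp.ncard}

/-- Membership in the class `𝓕_cr`. -/
def IsFcr (G : SimpleGraph V) : Prop :=
  (G.chromaticNumber = 2 ∧ GcdOne (DSet G) ∧ GcdOne (compOrders G)) ∨
  (3 ≤ G.chromaticNumber ∧ GcdOne (DSet G))

/-- `H` is a tiling whose tiles satisfy the (isomorphism-invariant) predicate `tile`:
the vertex set partitions into parts with no edges of `H` between distinct parts, each part
inducing a graph satisfying `tile`. -/
def IsTiling (H : SimpleGraph V) (tile : ∀ (W : Type) [Fintype W], SimpleGraph W → Prop) : Prop :=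
  ∃ P : Set (Set V), Setoid.IsPartition P ∧
    (∀ p ∈ P, ∀ q ∈ P, p ≠ q → ∀ u ∈ p, ∀ v ∈ q, ¬ H.Adj u v) ∧
    ∀ p ∈ P, tile ↥p (H.induce p)

/-- Tiles of order at most `w`. -/
def TileLe (w : ℕ) (W : Type) [Fintype W] (F : SimpleGraph W) : Prop := Fintype.card W ≤ w

/-- Tiles in `𝓕(k, w)`: properly `k`-colourable of order at most `w` (real bound `w`). -/
def TileCol (k : ℕ) (w : ℝ) (W : Type) [Fintype W] (F : SimpleGraph W) : Prop :=
  F.Colorable k ∧ (Fintype.card W : ℝ) ≤ w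

/-- Tiles in `𝓕_cr(k, w)` (real bound `w`). -/
def TileFcr (k : ℕ) (w : ℝ) (W : Type) [Fintype W] (F : SimpleGraph W) : Prop :=
  IsFcr F ∧ F.Colorable k ∧ (Fintype.card W : ℝ) ≤ w

/-- Tiles in `𝓕_c(k, w)` (real bound `w`). -/
def TileFc (k : ℕ) (w : ℝ) (W : Type) [Fintype W] (F : SimpleGraph W) : Prop :=
  GcdOne (compOrders F) ∧ F.Colorable k ∧ (Fintype.card W : ℝ) ≤ w

/-- Tiles isomorphic to a fixed graph `F₀`. -/
def TileIso {m : ℕ} (F₀ : SimpleGraph (Fin m)) (W : Type) [Fintype W]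
    (F : SimpleGraph W) : Prop :=
  Nonempty (F ≃g F₀)

/-- `G` contains a copy of `H` as a (not necessarily induced) subgraph. -/
def ContainsCopy {V' : Type} (G : SimpleGraph V) (H : SimpleGraph V') : Prop :=
  ∃ f : V' → V, Function.Injective f ∧ ∀ ⦃u v⦄, H.Adj u v → G.Adj (f u) (f v)

/-- `H` is properly `(k, s)`-flexi-chromatic. -/
def ProperlyFlexi (H : SimpleGraph V) (k s : ℕ) : Prop :=
  ∃ φ, ProperCol H k φ ∧ ∀ w : Fin k → ℤ, ∑ i, w i = 0 → (∀ i, |w i| ≤ (s : ℤ)) →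
    ∃ φ', ProperCol H k φ' ∧
      ∀ i : Fin k, (classCard φ (i : ℕ) : ℤ) - classCard φ' (i : ℕ) = w i

/-- `H` is topologically `(k, s)`-flexi-chromatic. -/
def TopFlexi (H : SimpleGraph V) (k s : ℕ) : Prop :=
  ∃ φ, TopCol H k φ ∧ ∀ w : Fin k → ℤ, ∑ i, w i = 0 → (∀ i, |w i| ≤ (s : ℤ)) →
    ∃ φ', TopCol H k φ' ∧
      ∀ i : Fin k, (classCard φ (i : ℕ) : ℤ) - classCard φ' (i : ℕ) = w i

/-- `A` is a union of connected components of `H` (the vertex set of a subtiling). -/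
def CompClosed (H : SimpleGraph V) (A : Set V) : Prop :=
  ∀ ⦃u v⦄, H.Reachable u v → u ∈ A → v ∈ A

/-- `H` contains `t` pairwise disjoint properly `(k, s)`-flexi-chromatic subtilings together
with one further disjoint topologically `(ℓ, s')`-flexi-chromatic subtiling, each of order at
most `w'`. -/
def HasFlexiSubtilings (H : SimpleGraph V) (t ℓ k s s' w' : ℕ) : Prop :=
  ∃ (A : Fin t → Set V) (B : Set V),
    (∀ i, CompClosed H (A i)) ∧ CompClosed H B ∧
    (∀ i j, i ≠ j → Disjoint (A i) (A j)) ∧ (∀ i, Disjoint (A i) B) ∧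
    (∀ i, (A i).ncard ≤ w') ∧ B.ncard ≤ w' ∧
    (∀ i, ProperlyFlexi (H.induce (A i)) k s) ∧
    TopFlexi (H.induce B) ℓ s'

/-- `H ∈ ℋ(n, w, Δ; χ; t, ℓ, w')`. -/
def InH (H : SimpleGraph V) (n w : ℕ) (Δ χ : ℝ) (t ℓ w' : ℕ) : Prop :=
  Fintype.card V ≤ n ∧ (∀ v, (ndeg H v : ℝ) ≤ Δ) ∧ IsTiling H (TileLe w) ∧
  critR H ≤ χ ∧ HasFlexiSubtilings H t ℓ ⌈χ⌉₊ (⌈χ⌉₊ * w) w w'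

/-- The tight adjacency graph `T(J)` on the edge set `E` of a `k`-uniform hypergraph. -/
def TGraph (k : ℕ) (E : Set (Finset V)) : SimpleGraph ↥E :=
  SimpleGraph.fromRel fun e f => ((e : Finset V) ∩ (f : Finset V)).card = k - 1

/-- The number of tight components. -/
def tightCount (k : ℕ) (E : Set (Finset V)) : ℕ := Nat.card (TGraph k E).ConnectedComponent

/-- The vertex support of a tight component. -/
def tcSupp (k : ℕ) (E : Set (Finset V)) (c : (TGraph k E).ConnectedComponent) : Set V :=
  {v | ∃ e : ↥E, (TGraph k E).connectedComponentMk e = c ∧ v ∈ (e : Finset V)}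

/-- The loose adjacency graph `L(J)` on the tight components. -/
def LGraph (k : ℕ) (E : Set (Finset V)) : SimpleGraph (TGraph k E).ConnectedComponent :=
  SimpleGraph.fromRel fun c c' => (tcSupp k E c ∩ tcSupp k E c').Nonempty

/-- The number of loose components. -/
def looseCount (k : ℕ) (E : Set (Finset V)) : ℕ := Nat.card (LGraph k E).ConnectedComponent

/-- `(t, ℓ)`-connectedness: some vertex-spanning subhypergraph has at most `t` tight
components and at most `ℓ` loose components. -/
def ConnectedTL (k : ℕ) (E : Set (Finset V)) (t ℓ : ℕ) : Prop :=
  ∃ E' ⊆ E, (∀ v : V, ∃ e ∈ E', v ∈ e) ∧ tightCount k E' ≤ t ∧ looseCount k E' ≤ ℓ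

/-- Every vertex is linked to some edge. -/
def Linked (k : ℕ) (E : Set (Finset V)) : Prop :=
  ∀ v : V, ∃ f ∈ E, v ∉ f ∧ ∃ e ∈ E, v ∈ e ∧ (e ∩ f).card = k - 1

/-- `ω` is a fractional `F`-tiling of `G`. -/
def IsFracTiling {α : Type} [Fintype α] (F : SimpleGraph α) (G : SimpleGraph V)
    (ω : (F →g G) → ℝ) : Prop :=
  (∀ θ, 0 ≤ ω θ ∧ ω θ ≤ 1) ∧
  ∀ v : V, (∑ᶠ θ : F →g G, ω θ * ({u | θ u = v}.ncard : ℝ)) ≤ 1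

/-- The weight of a fractional tiling. -/
def fracWeight {α : Type} [Fintype α] (F : SimpleGraph α) (G : SimpleGraph V)
    (ω : (F →g G) → ℝ) : ℝ :=
  (Fintype.card α : ℝ) * ∑ᶠ θ : F →g G, ω θ

/-- For a rational `q > 1`, the numerator `a` in `q = ⌊q⌋ + a/b`. -/
def aB (q : ℚ) : ℕ := (q - (⌊q⌋ : ℚ)).num.toNat

/-- For a rational `q > 1`, the denominator `b` in `q = ⌊q⌋ + a/b`. -/
def bB (q : ℚ) : ℕ := (q - (⌊q⌋ : ℚ)).den

/-- The bottle graph `B_q`: complete `⌈q⌉`-partite with one part of size `a` and the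
remaining `⌈q⌉ − 1` parts of size `b`. -/
def Bgraph (q : ℚ) : SimpleGraph (Σ i : Fin ⌈q⌉₊, Fin (if (i : ℕ) = 0 then aB q else bB q)) :=
  SimpleGraph.completeMultipartiteGraph fun i : Fin ⌈q⌉₊ => Fin (if (i : ℕ) = 0 then aB q else bB q)

/-- `G` is a `(q, ρ; t, ℓ)`-tiling framework. -/
def TilingFramework (G : SimpleGraph V) (q : ℚ) (ρ : ℝ) (t ℓ : ℕ) : Prop :=
  (∃ ω, IsFracTiling (Bgraph q) G ω ∧
      (1 - ρ) * (Fintype.card V : ℝ) ≤ fracWeight (Bgraph q) G ω) ∧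
  ConnectedTL ⌈q⌉₊ (G.cliqueSet ⌈q⌉₊) t ℓ ∧
  Linked ⌈q⌉₊ (G.cliqueSet ⌈q⌉₊)

/-- `G'` (on the vertex set `S`) is an `(ε, d)`-approximation of `G`. -/
def IsApprox (G : SimpleGraph V) (ε d : ℝ) (S : Set V) (G' : SimpleGraph ↥S) : Prop :=
  G' ≤ G.induce S ∧ (1 - ε) * (Fintype.card V : ℝ) ≤ (S.ncard : ℝ) ∧
  ∀ v : ↥S, (ndeg G (v : V) : ℝ) - d * (Fintype.card V : ℝ) ≤ (ndeg G' v : ℝ)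

/-- `G` is `μ`-robustly a `(q, ρ; t, ℓ)`-tiling framework. -/
def RobustFramework (G : SimpleGraph V) (μ : ℝ) (q : ℚ) (ρ : ℝ) (t ℓ : ℕ) : Prop :=
  ∀ (S : Set V) (G' : SimpleGraph ↥S), IsApprox G μ μ S G' → TilingFramework G' q ρ t ℓ

/-- `α(χ) = 1 − (⌈χ⌉ − 1)/χ`. -/
def alphaOf (χ : ℝ) : ℝ := 1 - ((⌈χ⌉₊ : ℝ) - 1) / χ

/-- The degree sequence of `G` is `(χ, μ)`-strong. -/
def DegSeqStrong (G : SimpleGraph V) (χ μ : ℝ) : Prop :=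
  ∃ e : Fin (Fintype.card V) ≃ V,
    (∀ i j, i ≤ j → ndeg G (e i) ≤ ndeg G (e j)) ∧
    ∀ i : Fin (Fintype.card V), ((i : ℕ) + 1 : ℝ) ≤ (Fintype.card V : ℝ) / χ →
      (1 - 1 / χ - alphaOf χ) * (Fintype.card V : ℝ) + χ * alphaOf χ * ((i : ℕ) + 1) +
          μ * (Fintype.card V : ℝ) ≤ (ndeg G (e i) : ℝ)

/-- `G` is uniformly `(ρ, d)`-dense. -/
def UniformlyDense (G : SimpleGraph V) (ρ d : ℝ) : Prop :=
  ∀ U : Set V, d * (U.ncard : ℝ) ^ 2 / 2 - ρ * (Fintype.card V : ℝ) ^ 2 ≤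
    ((G.induce U).edgeSet.ncard : ℝ)

/-- `p`-approximately `(k, s)`-flexi-chromatic with central colouring `φ`, generic in the
kind of colouring `Col` (proper or topological). -/
def ApproxFlexiWith {V : Type} (Col : ℕ → (V → ℕ) → Prop) (k s p : ℕ) (φ : V → ℕ) : Prop :=
  Col k φ ∧ ∀ w : Fin k → ℤ, ∑ i, w i = 0 → (∀ i, |w i| ≤ (s : ℤ)) →
    ∃ φ', Col k φ' ∧
      ∀ i : Fin k, |(classCard φ (i : ℕ) : ℤ) - classCard φ' (i : ℕ) - w i| ≤ (p : ℤ)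

/-- The vertex support of a hypergraph edge set. -/
def hsupp (E : Set (Finset V)) : Set V := {v | ∃ e ∈ E, v ∈ e}

/-- The reachability graph `ℛ(T)` on the vertex set of `T`. -/
def RGraph (k : ℕ) (T : Set (Finset V)) : SimpleGraph ↥(hsupp T) :=
  SimpleGraph.fromRel fun x y => ∃ e ∈ T, ∃ f ∈ T,
    (x : V) ∈ e ∧ (x : V) ∉ f ∧ (y : V) ∈ f ∧ (y : V) ∉ e ∧ (e ∩ f).card = k - 1

end

section Reachability

variable {W : Type} {k : ℕ} {T : Set (Finset W)}

/-- A reachability component meeting an edge meets every tightly adjacent edge. -/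
theorem exists_mem_connectedComponent_of_adj (hk : 0 < k) (hU : ∀ e ∈ T, e.card = k)
    {e f : ↥T} (hef : (TGraph k T).Adj e f) {c : (RGraph k T).ConnectedComponent}
    (h : ∃ v : ↥(hsupp T), (v : W) ∈ (e : Finset W) ∧
      (RGraph k T).connectedComponentMk v = c) :
    ∃ v : ↥(hsupp T), (v : W) ∈ (f : Finset W) ∧
      (RGraph k T).connectedComponentMk v = c := by
  obtain ⟨v, hve, rfl⟩ := h
  by_cases hvf : (v : W) ∈ (f : Finset W)
  · exact ⟨v, hvf, rfl⟩
  have hcard : ((e : Finset W) ∩ (f : Finset W)).card = k - 1 := by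
    rcases hef.2 with h | h
    · exact h
    · rwa [Finset.inter_comm]
  obtain ⟨w, hwf, hwe⟩ : ∃ w ∈ (f : Finset W), w ∉ (e : Finset W) := by
    by_contra! hsub
    rw [Finset.inter_eq_right.mpr hsub, hU f f.2] at hcard
    omega
  refine ⟨⟨w, f, f.2, hwf⟩, hwf, SimpleGraph.ConnectedComponent.sound ?_⟩
  refine SimpleGraph.Adj.reachable ⟨fun h => hwe ?_, Or.inr ?_⟩
  · rw [show w = (v : W) from congrArg Subtype.val h]
    exact hve
  · exact ⟨e, e.2, f, f.2, hve, hvf, hwf, hwe, hcard⟩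

/-- If `T` is tightly connected, every edge meets every reachability component. -/
theorem exists_mem_connectedComponent (hk : 0 < k) (hU : ∀ e ∈ T, e.card = k)
    (hconn : (TGraph k T).Preconnected) (f : ↥T) (c : (RGraph k T).ConnectedComponent) :
    ∃ v : ↥(hsupp T), (v : W) ∈ (f : Finset W) ∧
      (RGraph k T).connectedComponentMk v = c := by
  obtain ⟨v, rfl⟩ := c.exists_rep
  obtain ⟨e, he, hve⟩ := v.2
  obtain ⟨p⟩ := hconn ⟨e, he⟩ f
  have key : ∀ {a b : ↥T}, (TGraph k T).Walk a b →
      (∃ w : ↥(hsupp T), (w : W) ∈ (a : Finset W) ∧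
        (RGraph k T).connectedComponentMk w = (RGraph k T).connectedComponentMk v) →
      ∃ w : ↥(hsupp T), (w : W) ∈ (b : Finset W) ∧
        (RGraph k T).connectedComponentMk w = (RGraph k T).connectedComponentMk v := by
    intro a b q h
    induction q with
    | nil => exact h
    | cons hadj _ ih => exact ih (exists_mem_connectedComponent_of_adj hk hU hadj h)
  exact key p ⟨v, hve, rfl⟩

end Reachability

/-- Proposition 8.1 (tight components have at most `k` reachability
components, each meeting every edge). -/
theorem reachability (k : ℕ) (hk : 2 ≤ k) {W : Type} [Fintype W] (T : Set (Finset W))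
    (hU : ∀ e ∈ T, e.card = k) (hconn : (TGraph k T).Connected) :
    Nat.card (RGraph k T).ConnectedComponent ≤ k ∧
    ∀ e ∈ T, ∀ c : (RGraph k T).ConnectedComponent,
      ∃ v : ↥(hsupp T), (v : W) ∈ e ∧ (RGraph k T).connectedComponentMk v = c := by
  have hmeet : ∀ e ∈ T, ∀ c : (RGraph k T).ConnectedComponent,
      ∃ v : ↥(hsupp T), (v : W) ∈ e ∧ (RGraph k T).connectedComponentMk v = c :=
    fun e he => exists_mem_connectedComponent (by omega) hU hconn.preconnected ⟨e, he⟩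
  refine ⟨?_, hmeet⟩
  obtain ⟨e, he⟩ := hconn.nonempty
  have hsurj : Function.Surjective fun v : ↥e =>
      (RGraph k T).connectedComponentMk ⟨v, e, he, v.2⟩ := by
    intro c
    obtain ⟨v, hv, hvc⟩ := hmeet e he c
    exact ⟨⟨v, hv⟩, hvc⟩
  have hle := Nat.card_le_card_of_surjective _ hsurj
  rwa [Nat.card_eq_fintype_card, Nat.card_eq_fintype_card, Fintype.card_coe, hU e he,
    ← Nat.card_eq_fintype_card] at hle

end Paper
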